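/- There exist real parameters M̂₁, M̂₂ (numerically M̂₁ ≈ −0.9336687216264129, M̂₂ ≈ 1.99067193080051) such that for B̂ = 1 the inverse-form 3D Hénon map G has a point p ∈ ℝ³ of exact period 6 (G⁶(p) = p and Gʲ(p) ≠ p for 1 ≤ j ≤ 5) at which trace D(G⁶)(p) = −1 and det(D(G⁶)(p) − I) = 0; since det D(G⁶)(p) = B̂⁶ = 1, the Jacobian of the sixth iterate at p has eigenvalues (−1, −1, +1). -/

import Mathlib

open Polynomial

/-- The inverse-form 3D Hénon map `G(x, y, z) = (y, z, M̂₁ + B̂·x + M̂₂·z − y²)`. -/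
noncomputable def ghenon (M₁ M₂ B : ℝ) : ℝ × ℝ × ℝ → ℝ × ℝ × ℝ :=
  fun p => (p.2.1, p.2.2, M₁ + B * p.1 + M₂ * p.2.2 - p.2.1 ^ 2)

open Matrix in
/-- A matrix whose absolute row sums are at most `K` is `K`-bounded in the sup norm. -/
theorem norm_mulVec_le_of_sum_abs_le {ι : Type*} [Fintype ι] (M : Matrix ι ι ℝ) {K : ℝ}
    (hK : 0 ≤ K) (hM : ∀ i, ∑ j, |M i j| ≤ K) (x : ι → ℝ) : ‖M *ᵥ x‖ ≤ K * ‖x‖ := by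
  refine (pi_norm_le_iff_of_nonneg (by positivity)).2 fun i => ?_
  calc ‖(M *ᵥ x) i‖ ≤ ∑ j, |M i j| * ‖x‖ := by
        refine (norm_sum_le _ _).trans (Finset.sum_le_sum fun j _ => ?_)
        rw [norm_mul]
        exact mul_le_mul_of_nonneg_left (norm_le_pi_norm x j) (norm_nonneg _)
    _ = (∑ j, |M i j|) * ‖x‖ := (Finset.sum_mul ..).symm
    _ ≤ K * ‖x‖ := mul_le_mul_of_nonneg_right (hM i) (norm_nonneg x)

open Matrix in
/-- A quantitative simplified Newton method: an approximate zero `c` of `F`, together with an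
approximate derivative `J` and an approximate inverse `A` of `J`, yields a true zero near `c`. -/
theorem exists_zero_of_approx_inverse {ι : Type*} [Fintype ι] [DecidableEq ι]
    (F : (ι → ℝ) → ι → ℝ) (A J : Matrix ι ι ℝ) (c : ι → ℝ) {r K ε δ : ℝ}
    (hr : 0 ≤ r) (hK : 0 ≤ K)
    (hAJ : ∀ i, ∑ j, |(1 - A * J) i j| ≤ 1 / 4) (hA : ∀ i, ∑ j, |A i j| ≤ K)
    (hF : ∀ u v, ‖u - c‖ ≤ r → ‖v - c‖ ≤ r → ‖F u - F v - J *ᵥ (u - v)‖ ≤ ε * ‖u - v‖)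
    (hε : K * ε ≤ 1 / 4) (h0 : ‖F c‖ ≤ δ) (hδ : K * δ ≤ r / 2) :
    ∃ z, ‖z - c‖ ≤ r ∧ F z = 0 := by
  have hsub := norm_mulVec_le_of_sum_abs_le _ (by norm_num) hAJ
  have hmul := norm_mulVec_le_of_sum_abs_le A hK hA
  have hAunit : IsUnit A := by
    have hunit : IsUnit (A * J) := by
      rw [← mulVec_injective_iff_isUnit]
      intro x y hxy
      have h := hsub (x - y)
      rw [sub_mulVec, one_mulVec, mulVec_sub, show (A * J) *ᵥ x = (A * J) *ᵥ y from hxy, sub_self,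
        sub_zero] at h
      have : ‖x - y‖ = 0 := le_antisymm (by linarith [norm_nonneg (x - y)]) (norm_nonneg _)
      exact sub_eq_zero.1 (norm_eq_zero.1 this)
    rw [isUnit_iff_isUnit_det, det_mul] at hunit
    exact (isUnit_iff_isUnit_det A).2 (isUnit_of_mul_isUnit_left hunit)
  set T : (ι → ℝ) → ι → ℝ := fun z => z - A *ᵥ F z with hT
  have hlip : ∀ u v, ‖u - c‖ ≤ r → ‖v - c‖ ≤ r → ‖T u - T v‖ ≤ 1 / 2 * ‖u - v‖ := by
    intro u v hu hv
    have heq : T u - T v = (1 - A * J) *ᵥ (u - v) - A *ᵥ (F u - F v - J *ᵥ (u - v)) := by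
      simp only [hT, sub_mulVec, one_mulVec, mulVec_sub, mulVec_mulVec]
      abel
    rw [heq]
    refine (norm_sub_le _ _).trans ?_
    have h1 := hsub (u - v)
    have h2 := (hmul _).trans (mul_le_mul_of_nonneg_left (hF u v hu hv) hK)
    have h3 := mul_le_mul_of_nonneg_right hε (norm_nonneg (u - v))
    linarith
  have hTc : ‖T c - c‖ ≤ r / 2 := by
    have : T c - c = -(A *ᵥ F c) := by simp [hT]
    rw [this, norm_neg]
    exact ((hmul _).trans (mul_le_mul_of_nonneg_left h0 hK)).trans hδ
  have hmaps : Set.MapsTo T (Metric.closedBall c r) (Metric.closedBall c r) := by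
    intro u hu
    rw [mem_closedBall_iff_norm] at hu ⊢
    have h1 := hlip u c hu (by simpa using hr)
    calc ‖T u - c‖ ≤ ‖T u - T c‖ + ‖T c - c‖ := norm_sub_le_norm_sub_add_norm_sub ..
      _ ≤ r := by linarith
  have hcontr : ContractingWith (1 / 2) (hmaps.restrict T _ _) := by
    refine ⟨by norm_num, LipschitzWith.of_dist_le_mul fun u v => ?_⟩
    have := hlip u v (mem_closedBall_iff_norm.1 u.2) (mem_closedBall_iff_norm.1 v.2)
    rw [Subtype.dist_eq, Subtype.dist_eq, dist_eq_norm, dist_eq_norm]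
    simpa using this
  obtain ⟨z, hz, hfix, -⟩ := hcontr.exists_fixedPoint' Metric.isClosed_closedBall.isComplete hmaps
    (Metric.mem_closedBall_self hr) (edist_ne_top _ _)
  refine ⟨z, mem_closedBall_iff_norm.1 hz, ?_⟩
  have hzero : A *ᵥ F z = A *ᵥ 0 := by
    have : z - A *ᵥ F z = z := hfix
    rw [mulVec_zero]
    simpa using this
  exact mulVec_injective_iff_isUnit.2 hAunit hzero

/-- An endomorphism of a 3-dimensional space with determinant `1` and eigenvalues `1` and `-1`
has characteristic polynomial `(X + 1) ^ 2 * (X - 1)`. -/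
theorem charpoly_eq_of_det_eq_one_of_eigenvectors {K V : Type*} [Field K] [NeZero (2 : K)]
    [AddCommGroup V] [Module K V] [FiniteDimensional K V]
    (hV : Module.finrank K V = 3) (f : V →ₗ[K] V) (hdet : LinearMap.det f = 1) {v w : V}
    (hv : v ≠ 0) (hfv : f v = v) (hw : w ≠ 0) (hfw : f w = -w) : f.charpoly = (X + 1) ^ 2 * (X - 1) := by
  have h1 : f.charpoly.IsRoot 1 :=
    (Module.End.hasEigenvalue_iff_isRoot_charpoly f 1).1
      (Module.End.hasEigenvalue_of_hasEigenvector
        (Module.End.hasEigenvector_iff.2 ⟨Module.End.mem_eigenspace_iff.2 (by simpa using hfv), hv⟩))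
  have h2 : f.charpoly.IsRoot (-1) :=
    (Module.End.hasEigenvalue_iff_isRoot_charpoly f (-1)).1
      (Module.End.hasEigenvalue_of_hasEigenvector
        (Module.End.hasEigenvector_iff.2 ⟨Module.End.mem_eigenspace_iff.2 (by simpa using hfw), hw⟩))
  have hdeg : f.charpoly.natDegree = 3 := by rw [LinearMap.charpoly_natDegree, hV]
  have hlead : f.charpoly.coeff 3 = 1 := by
    have := f.charpoly_monic.coeff_natDegree
    rwa [hdeg] at this
  have hconst : f.charpoly.coeff 0 = -1 := by
    have := f.det_eq_sign_charpoly_coeff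
    rw [hdet, hV] at this
    linear_combination this
  have hexp := f.charpoly.as_sum_range_C_mul_X_pow
  rw [hdeg] at hexp
  simp only [Finset.sum_range_succ, Finset.sum_range_zero, hlead, hconst] at hexp
  rw [Polynomial.IsRoot, hexp] at h1 h2
  simp only [zero_add, map_neg, map_one, pow_zero, mul_one, pow_one, eval_add, eval_neg, eval_one,
    eval_mul, eval_C, eval_X, eval_pow, one_pow] at h1 h2
  have hc1 : f.charpoly.coeff 1 = -1 :=
    mul_left_cancel₀ (NeZero.ne (2 : K)) (by linear_combination h1 - h2)
  have hc2 : f.charpoly.coeff 2 = 1 :=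
    mul_left_cancel₀ (NeZero.ne (2 : K)) (by linear_combination h1 + h2)
  rw [hexp, hc1, hc2]
  simp only [map_neg, map_one]
  ring

/-- The derivative of `ghenon M₁ M₂ 1` at a point with second coordinate `y`. -/
noncomputable def ghenonDeriv (M₂ y : ℝ) : ℝ × ℝ × ℝ →L[ℝ] ℝ × ℝ × ℝ :=
  let fst := ContinuousLinearMap.fst ℝ ℝ (ℝ × ℝ)
  let snd := ContinuousLinearMap.snd ℝ ℝ (ℝ × ℝ)
  let mid := (ContinuousLinearMap.fst ℝ ℝ ℝ).comp snd
  let last := (ContinuousLinearMap.snd ℝ ℝ ℝ).comp snd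
  mid.prod (last.prod (fst + M₂ • last - (2 * y) • mid))

@[simp]
theorem ghenonDeriv_apply (M₂ y a b c : ℝ) :
    ghenonDeriv M₂ y (a, b, c) = (b, c, a + M₂ * c - 2 * y * b) := by
  simp [ghenonDeriv]

theorem hasFDerivAt_ghenon (M₁ M₂ a y c : ℝ) :
    HasFDerivAt (ghenon M₁ M₂ 1) (ghenonDeriv M₂ y) (a, y, c) := by
  have hfst : HasFDerivAt (fun p : ℝ × ℝ × ℝ => p.1) (ContinuousLinearMap.fst ℝ ℝ (ℝ × ℝ))
    (a, y, c) := hasFDerivAt_fst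
  have hsnd : HasFDerivAt (fun p : ℝ × ℝ × ℝ => p.2) (ContinuousLinearMap.snd ℝ ℝ (ℝ × ℝ))
    (a, y, c) := hasFDerivAt_snd
  have hmid := hsnd.fst
  have hlast := hsnd.snd
  have h := hmid.prodMk (hlast.prodMk
    ((((hfst.const_mul 1).const_add M₁).add (hlast.const_mul M₂)).sub (hmid.pow 2)))
  refine h.congr_fderiv ?_
  ext <;> simp [ghenonDeriv]

theorem HasFDerivAt.iterate_succ' {𝕜 E : Type*} [NontriviallyNormedField 𝕜]
    [NormedAddCommGroup E] [NormedSpace 𝕜 E] {f : E → E} {x y : E} {n : ℕ} {f' g' : E →L[𝕜] E}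
    (hf : HasFDerivAt f^[n] f' x) (hy : f^[n] x = y) (hg : HasFDerivAt f g' y) :
    HasFDerivAt f^[n + 1] (g'.comp f') x := by
  rw [Function.iterate_succ']
  exact (hy ▸ hg).comp x hf

theorem det_ghenonDeriv (M₂ y : ℝ) : LinearMap.det (ghenonDeriv M₂ y).toLinearMap = 1 := by
  let e : (ℝ × ℝ × ℝ) ≃ₗ[ℝ] (Fin 3 → ℝ) :=
    { toFun := fun p => ![p.1, p.2.1, p.2.2]
      invFun := fun f => (f 0, f 1, f 2)
      map_add' := fun p q => by ext i; fin_cases i <;> simp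
      map_smul' := fun a p => by ext i; fin_cases i <;> simp
      left_inv := fun p => rfl
      right_inv := fun f => by ext i; fin_cases i <;> simp }
  have hmat : (e : (ℝ × ℝ × ℝ) →ₗ[ℝ] (Fin 3 → ℝ)) ∘ₗ (ghenonDeriv M₂ y).toLinearMap ∘ₗ
      (e.symm : (Fin 3 → ℝ) →ₗ[ℝ] (ℝ × ℝ × ℝ)) =
      Matrix.toLin' !![0, 1, 0; 0, 0, 1; 1, -(2 * y), M₂] := by
    refine LinearMap.ext fun f => ?_
    have he : ∀ p, e p = ![p.1, p.2.1, p.2.2] := fun _ => rfl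
    have hf : e.symm f = (f 0, f 1, f 2) := rfl
    ext i
    simp only [LinearMap.comp_apply, LinearEquiv.coe_coe, he, hf, ContinuousLinearMap.coe_coe,
      ghenonDeriv_apply]
    fin_cases i
    · simp [Matrix.mulVec, dotProduct, Fin.sum_univ_succ]
    · simp [Matrix.mulVec, dotProduct, Fin.sum_univ_succ]
    · simp [Matrix.mulVec, dotProduct, Fin.sum_univ_succ]
      ring
  rw [← LinearMap.det_conj _ e, hmat, LinearMap.det_toLin', Matrix.det_fin_three]
  simp

/-- The equations, in the unknowns `z = (x₀, …, x₅, M₁, M₂, v₁, …, v₅, w₁, …, w₅)`, saying that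
`x` is a 6-periodic orbit of the 3D Hénon recurrence and that its linearization along `x` has a
6-periodic solution `v` with `v₀ = 1` and a 6-antiperiodic solution `w` with `w₀ = 1`. -/
def orbitSystem (z : Fin 18 → ℝ) : Fin 18 → ℝ :=
  ![z 3 - z 0 - z 6 - z 7 * z 2 + z 1 ^ 2,
    z 4 - z 1 - z 6 - z 7 * z 3 + z 2 ^ 2,
    z 5 - z 2 - z 6 - z 7 * z 4 + z 3 ^ 2,
    z 0 - z 3 - z 6 - z 7 * z 5 + z 4 ^ 2,
    z 1 - z 4 - z 6 - z 7 * z 0 + z 5 ^ 2,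
    z 2 - z 5 - z 6 - z 7 * z 1 + z 0 ^ 2,
    z 10 - 1 - z 7 * z 9 + 2 * (z 1 * z 8),
    z 11 - z 8 - z 7 * z 10 + 2 * (z 2 * z 9),
    z 12 - z 9 - z 7 * z 11 + 2 * (z 3 * z 10),
    1 - z 10 - z 7 * z 12 + 2 * (z 4 * z 11),
    z 8 - z 11 - z 7 + 2 * (z 5 * z 12),
    z 9 - z 12 - z 7 * z 8 + 2 * z 0,
    z 15 - 1 - z 7 * z 14 + 2 * (z 1 * z 13),
    z 16 - z 13 - z 7 * z 15 + 2 * (z 2 * z 14),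
    z 17 - z 14 - z 7 * z 16 + 2 * (z 3 * z 15),
    -1 - z 15 - z 7 * z 17 + 2 * (z 4 * z 16),
    -z 13 - z 16 + z 7 + 2 * (z 5 * z 17),
    -z 14 - z 17 + z 7 * z 13 - 2 * z 0]

/-- The derivative of `orbitSystem` at `m` in the direction `h`. -/
def orbitSystemDeriv (m h : Fin 18 → ℝ) : Fin 18 → ℝ :=
  ![h 3 - h 0 - h 6 - (m 7 * h 2 + h 7 * m 2) + 2 * (m 1 * h 1),
    h 4 - h 1 - h 6 - (m 7 * h 3 + h 7 * m 3) + 2 * (m 2 * h 2),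
    h 5 - h 2 - h 6 - (m 7 * h 4 + h 7 * m 4) + 2 * (m 3 * h 3),
    h 0 - h 3 - h 6 - (m 7 * h 5 + h 7 * m 5) + 2 * (m 4 * h 4),
    h 1 - h 4 - h 6 - (m 7 * h 0 + h 7 * m 0) + 2 * (m 5 * h 5),
    h 2 - h 5 - h 6 - (m 7 * h 1 + h 7 * m 1) + 2 * (m 0 * h 0),
    h 10 - (m 7 * h 9 + h 7 * m 9) + 2 * (m 1 * h 8 + h 1 * m 8),
    h 11 - h 8 - (m 7 * h 10 + h 7 * m 10) + 2 * (m 2 * h 9 + h 2 * m 9),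
    h 12 - h 9 - (m 7 * h 11 + h 7 * m 11) + 2 * (m 3 * h 10 + h 3 * m 10),
    -h 10 - (m 7 * h 12 + h 7 * m 12) + 2 * (m 4 * h 11 + h 4 * m 11),
    h 8 - h 11 - h 7 + 2 * (m 5 * h 12 + h 5 * m 12),
    h 9 - h 12 - (m 7 * h 8 + h 7 * m 8) + 2 * h 0,
    h 15 - (m 7 * h 14 + h 7 * m 14) + 2 * (m 1 * h 13 + h 1 * m 13),
    h 16 - h 13 - (m 7 * h 15 + h 7 * m 15) + 2 * (m 2 * h 14 + h 2 * m 14),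
    h 17 - h 14 - (m 7 * h 16 + h 7 * m 16) + 2 * (m 3 * h 15 + h 3 * m 15),
    -h 15 - (m 7 * h 17 + h 7 * m 17) + 2 * (m 4 * h 16 + h 4 * m 16),
    -h 13 - h 16 + h 7 + 2 * (m 5 * h 17 + h 5 * m 17),
    -h 14 - h 17 + (m 7 * h 13 + h 7 * m 13) - 2 * h 0]

/-- An approximate zero of `orbitSystem`, scaled by `10 ^ 15`. -/
def approxZero : Fin 18 → ℤ :=
  ![663815702663599, 913442745967146, 1220643948207236, 1325670976074841, 1128778377594885, 776599122146278, -933668721626413, 1990671930800510, 3384307683794036, 2378495449153911, -447938479597631, -3313983025962769, -3030919456840168, 1009762278106021, 882277453789656, 911604906262802, 670575307767346, -199803435310019]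

/-- The Jacobian matrix of `orbitSystem` at the approximate zero, scaled by `10 ^ 15`. -/
def approxJacobian : Matrix (Fin 18) (Fin 18) ℤ :=
  !![-1000000000000000, 1826885491934292, -1990671930800510, 1000000000000000, 0, 0, -1000000000000000, -1220643948207236, 0, 0, 0, 0, 0, 0, 0, 0, 0, 0;
    0, -1000000000000000, 2441287896414472, -1990671930800510, 1000000000000000, 0, -1000000000000000, -1325670976074841, 0, 0, 0, 0, 0, 0, 0, 0, 0, 0;
    0, 0, -1000000000000000, 2651341952149682, -1990671930800510, 1000000000000000, -1000000000000000, -1128778377594885, 0, 0, 0, 0, 0, 0, 0, 0, 0, 0;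
    1000000000000000, 0, 0, -1000000000000000, 2257556755189770, -1990671930800510, -1000000000000000, -776599122146278, 0, 0, 0, 0, 0, 0, 0, 0, 0, 0;
    -1990671930800510, 1000000000000000, 0, 0, -1000000000000000, 1553198244292556, -1000000000000000, -663815702663599, 0, 0, 0, 0, 0, 0, 0, 0, 0, 0;
    1327631405327198, -1990671930800510, 1000000000000000, 0, 0, -1000000000000000, -1000000000000000, -913442745967146, 0, 0, 0, 0, 0, 0, 0, 0, 0, 0;
    0, 6768615367588072, 0, 0, 0, 0, 0, -2378495449153911, 1826885491934292, -1990671930800510, 1000000000000000, 0, 0, 0, 0, 0, 0, 0;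
    0, 0, 4756990898307822, 0, 0, 0, 0, 447938479597631, -1000000000000000, 2441287896414472, -1990671930800510, 1000000000000000, 0, 0, 0, 0, 0, 0;
    0, 0, 0, -895876959195262, 0, 0, 0, 3313983025962769, 0, -1000000000000000, 2651341952149682, -1990671930800510, 1000000000000000, 0, 0, 0, 0, 0;
    0, 0, 0, 0, -6627966051925538, 0, 0, 3030919456840168, 0, 0, -1000000000000000, 2257556755189770, -1990671930800510, 0, 0, 0, 0, 0;
    0, 0, 0, 0, 0, -6061838913680336, 0, -1000000000000000, 1000000000000000, 0, 0, -1000000000000000, 1553198244292556, 0, 0, 0, 0, 0;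
    2000000000000000, 0, 0, 0, 0, 0, 0, -3384307683794036, -1990671930800510, 1000000000000000, 0, 0, -1000000000000000, 0, 0, 0, 0, 0;
    0, 2019524556212042, 0, 0, 0, 0, 0, -882277453789656, 0, 0, 0, 0, 0, 1826885491934292, -1990671930800510, 1000000000000000, 0, 0;
    0, 0, 1764554907579312, 0, 0, 0, 0, -911604906262802, 0, 0, 0, 0, 0, -1000000000000000, 2441287896414472, -1990671930800510, 1000000000000000, 0;
    0, 0, 0, 1823209812525604, 0, 0, 0, -670575307767346, 0, 0, 0, 0, 0, 0, -1000000000000000, 2651341952149682, -1990671930800510, 1000000000000000;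
    0, 0, 0, 0, 1341150615534692, 0, 0, 199803435310019, 0, 0, 0, 0, 0, 0, 0, -1000000000000000, 2257556755189770, -1990671930800510;
    0, 0, 0, 0, 0, -399606870620038, 0, 1000000000000000, 0, 0, 0, 0, 0, -1000000000000000, 0, 0, -1000000000000000, 1553198244292556;
    -2000000000000000, 0, 0, 0, 0, 0, 0, 1009762278106021, 0, 0, 0, 0, 0, 1990671930800510, -1000000000000000, 0, 0, -1000000000000000]

/-- An approximate inverse of the Jacobian matrix, scaled by `10 ^ 3`. -/
def approxInverse : Matrix (Fin 18) (Fin 18) ℤ :=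
  !![-4407, 12464, 13780, 6710, -8472, -20075, -1609, -1058, 291, 1268, 1225, -330, -41, -178, -189, -187, -224, -165;
    -12743, 42676, 45100, 20915, -28912, -67036, -5550, -3649, 1003, 4372, 4225, -1138, -8, -34, -36, -36, -43, -31;
    -9065, 30334, 31846, 14569, -20506, -47178, -3925, -2581, 709, 3092, 2988, -805, 26, 113, 120, 119, 143, 105;
    1490, -5373, -5333, -2515, 3481, 8251, 705, 464, -127, -555, -537, 145, 38, 167, 177, 175, 210, 155;
    11887, -41417, -43350, -19572, 28136, 64316, 5426, 3567, -980, -4275, -4131, 1112, 18, 78, 83, 82, 98, 72;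
    10421, -38053, -39449, -17834, 26141, 58774, 4997, 3285, -903, -3936, -3804, 1024, -26, -116, -123, -122, -146, -107;
    1125, 696, -415, -1229, -1221, 44, -12, -8, 2, 10, 10, -3, 16, 69, 73, 73, 87, 64;
    -1199, -782, 246, 992, 963, -220, 2, 1, 0, -1, -1, 0, -2, -10, -10, -10, -12, -9;
    486846, -1740429, -1812793, -819581, 1190773, 2695184, 228242, 149482, -40636, -177067, -169365, 48790, -132, -580, -615, -609, -731, -537;
    434934, -1537045, -1604089, -727581, 1049756, 2384024, 201619, 132650, -35454, -156443, -149953, 43067, -122, -537, -570, -565, -677, -498;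
    59798, -170907, -186130, -90296, 112301, 275235, 22953, 15674, -3127, -17540, -17699, 4300, 45, 196, 208, 206, 247, 181;
    -412258, 1527769, 1581124, 707156, -1051314, -2352478, -199605, -129878, 36318, 155229, 147264, -43962, 134, 587, 623, 617, 739, 543;
    -538972, 1955155, 2031313, 913999, -1340886, -3020609, -255960, -167040, 46021, 198580, 189652, -55719, 67, 293, 311, 308, 369, 271;
    19996, -73139, -75722, -33726, 49990, 112602, 9396, 6177, -1698, -7402, -7154, 1926, 444, 368, -40, -396, -446, 56;
    12025, -46896, -48012, -20654, 32440, 71097, 5918, 3891, -1069, -4662, -4506, 1213, 85, 457, 167, -383, -739, -219;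
    12085, -46613, -48104, -20865, 32490, 71008, 5825, 3829, -1052, -4588, -4435, 1194, 371, 297, 470, 26, -581, -483;
    29597, -105684, -110241, -49641, 72534, 163434, 13471, 8856, -2434, -10612, -10256, 2761, 928, 635, 266, 369, -61, -564;
    35383, -124419, -130037, -58901, 84990, 192984, 16007, 10523, -2892, -12610, -12187, 3281, 878, 622, 120, -42, 288, -349]

theorem approxInverse_mul_approxJacobian (i : Fin 18) :
    ∑ j, |((10 ^ 18 : ℤ) • (1 : Matrix (Fin 18) (Fin 18) ℤ)
      - approxInverse * approxJacobian) i j| ≤ 25 * 10 ^ 16 := by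
  revert i
  decide +kernel

theorem sum_abs_approxInverse_le (i : Fin 18) :
    ∑ j, |approxInverse i j| ≤ 11000 * 10 ^ 3 := by
  revert i
  decide +kernel

theorem orbitSystem_sub (u v : Fin 18 → ℝ) :
    orbitSystem u - orbitSystem v =
      orbitSystemDeriv (fun i => (u i + v i) / 2) (u - v) := by
  ext i
  fin_cases i <;> simp [orbitSystem, orbitSystemDeriv] <;> ring

open Matrix in
theorem approxJacobian_mulVec (h : Fin 18 → ℝ) :
    (approxJacobian.map fun a => (a : ℝ) / 10 ^ 15) *ᵥ h =
      orbitSystemDeriv (fun i => (approxZero i : ℝ) / 10 ^ 15) h := by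
  ext i
  fin_cases i <;>
  simp [approxJacobian, approxZero, orbitSystemDeriv, mulVec, dotProduct, Fin.sum_univ_succ] <;>
  ring

theorem norm_orbitSystemDeriv_sub_le {m c : Fin 18 → ℝ} {r : ℝ} (hr : 0 ≤ r)
    (hm : ‖m - c‖ ≤ r) (h : Fin 18 → ℝ) :
    ‖orbitSystemDeriv m h - orbitSystemDeriv c h‖ ≤ 6 * r * ‖h‖ := by
  have hb : ∀ a b, |(m a - c a) * h b| ≤ r * ‖h‖ := fun a b => by
    rw [abs_mul]
    exact mul_le_mul ((norm_le_pi_norm (m - c) a).trans hm) (norm_le_pi_norm h b)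
      (abs_nonneg _) hr
  have hl := fun a b => (abs_le.1 (hb a b)).1
  have hu := fun a b => (abs_le.1 (hb a b)).2
  have hB : 0 ≤ r * ‖h‖ := by positivity
  refine (pi_norm_le_iff_of_nonneg (by positivity)).2 fun i => ?_
  rw [Real.norm_eq_abs, abs_le]
  fin_cases i <;> simp [orbitSystemDeriv]
  · constructor <;> linarith [hl 7 2, hu 7 2, hl 2 7, hu 2 7, hl 1 1, hu 1 1]
  · constructor <;> linarith [hl 7 3, hu 7 3, hl 3 7, hu 3 7, hl 2 2, hu 2 2]
  · constructor <;> linarith [hl 7 4, hu 7 4, hl 4 7, hu 4 7, hl 3 3, hu 3 3]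
  · constructor <;> linarith [hl 7 5, hu 7 5, hl 5 7, hu 5 7, hl 4 4, hu 4 4]
  · constructor <;> linarith [hl 7 0, hu 7 0, hl 0 7, hu 0 7, hl 5 5, hu 5 5]
  · constructor <;> linarith [hl 7 1, hu 7 1, hl 1 7, hu 1 7, hl 0 0, hu 0 0]
  · constructor <;> linarith [hl 7 9, hu 7 9, hl 9 7, hu 9 7, hl 1 8, hu 1 8, hl 8 1, hu 8 1]
  · constructor <;> linarith [hl 7 10, hu 7 10, hl 10 7, hu 10 7, hl 2 9, hu 2 9, hl 9 2, hu 9 2]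
  · constructor <;> linarith [hl 7 11, hu 7 11, hl 11 7, hu 11 7, hl 3 10, hu 3 10, hl 10 3, hu 10
      3]
  · constructor <;> linarith [hl 7 12, hu 7 12, hl 12 7, hu 12 7, hl 4 11, hu 4 11, hl 11 4, hu 11
      4]
  · constructor <;> linarith [hl 5 12, hu 5 12, hl 12 5, hu 12 5]
  · constructor <;> linarith [hl 7 8, hu 7 8, hl 8 7, hu 8 7]
  · constructor <;> linarith [hl 7 14, hu 7 14, hl 14 7, hu 14 7, hl 1 13, hu 1 13, hl 13 1, hu 13
      1]
  · constructor <;> linarith [hl 7 15, hu 7 15, hl 15 7, hu 15 7, hl 2 14, hu 2 14, hl 14 2, hu 14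
      2]
  · constructor <;> linarith [hl 7 16, hu 7 16, hl 16 7, hu 16 7, hl 3 15, hu 3 15, hl 15 3, hu 15
      3]
  · constructor <;> linarith [hl 7 17, hu 7 17, hl 17 7, hu 17 7, hl 4 16, hu 4 16, hl 16 4, hu 16
      4]
  · constructor <;> linarith [hl 5 17, hu 5 17, hl 17 5, hu 17 5]
  · constructor <;> linarith [hl 7 13, hu 7 13, hl 13 7, hu 13 7]

theorem norm_orbitSystem_approxZero_le :
    ‖orbitSystem (fun i => (approxZero i : ℝ) / 10 ^ 15)‖ ≤ 1 / 10 ^ 13 := by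
  refine (pi_norm_le_iff_of_nonneg (by positivity)).2 fun i => ?_
  rw [Real.norm_eq_abs, abs_le]
  fin_cases i <;> simp [orbitSystem, approxZero] <;> norm_num

theorem exists_orbitSystem_eq_zero :
    ∃ z : Fin 18 → ℝ, ‖z - fun i => (approxZero i : ℝ) / 10 ^ 15‖ ≤ 1 / 10 ^ 7 ∧
      orbitSystem z = 0 := by
  refine exists_zero_of_approx_inverse orbitSystem
    (approxInverse.map fun a => (a : ℝ) / 10 ^ 3)
    (approxJacobian.map fun a => (a : ℝ) / 10 ^ 15)
    _ (K := 11000) (ε := 6 * (1 / 10 ^ 7)) (by norm_num) (by norm_num) (fun i => ?_) (fun i => ?_)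
    (fun u v hu hv => ?_) (by norm_num) norm_orbitSystem_approxZero_le (by norm_num)
  · have h := (Int.cast_le (R := ℝ)).2 (approxInverse_mul_approxJacobian i)
    push_cast at h
    have hentry : ∀ j, (1 -
        (approxInverse.map (fun a => (a : ℝ) / 10 ^ 3) : Matrix (Fin 18) (Fin 18) ℝ) *
        (approxJacobian.map (fun a => (a : ℝ) / 10 ^ 15) : Matrix (Fin 18) (Fin 18) ℝ)) i j =
        (((10 ^ 18 : ℤ) • (1 : Matrix (Fin 18) (Fin 18) ℤ)
          - approxInverse * approxJacobian) i j : ℤ) / 10 ^ 18 := fun j => by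
      simp only [Matrix.sub_apply, Matrix.mul_apply, Matrix.map_apply, Matrix.smul_apply,
        Matrix.one_apply]
      push_cast
      rw [sub_div, Finset.sum_div]
      congr 1
      · split_ifs <;> norm_num
      · exact Finset.sum_congr rfl fun k _ => by ring
    simp only [hentry, abs_div]
    rw [← Finset.sum_div, div_le_iff₀ (by positivity), abs_of_pos (by positivity)]
    exact h.trans (by norm_num)
  · have h := (Int.cast_le (R := ℝ)).2 (sum_abs_approxInverse_le i)
    push_cast at h
    simp only [Matrix.map_apply, abs_div]
    rw [← Finset.sum_div, div_le_iff₀ (by positivity), abs_of_pos (by positivity)]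
    exact h.trans (by norm_num)
  · rw [orbitSystem_sub, approxJacobian_mulVec]
    refine norm_orbitSystemDeriv_sub_le (by norm_num) ?_ _
    have hmid : (fun i => (u i + v i) / 2) - (fun i => (approxZero i : ℝ) / 10 ^ 15) =
        (1 / 2 : ℝ) • ((u - fun i => (approxZero i : ℝ) / 10 ^ 15) +
          (v - fun i => (approxZero i : ℝ) / 10 ^ 15)) := by
      ext i
      simp only [Pi.sub_apply, Pi.smul_apply, Pi.add_apply, smul_eq_mul]
      ring
    rw [hmid, norm_smul]
    have h := norm_add_le (u - fun i => (approxZero i : ℝ) / 10 ^ 15)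
      (v - fun i => (approxZero i : ℝ) / 10 ^ 15)
    norm_num at h hu hv ⊢
    linarith

/-- There exist parameters `M̂₁ ≈ −0.9336687216264129`, `M̂₂ ≈ 1.99067193080051` such
that for `B̂ = 1` the inverse-form 3D Hénon map has a point of exact period 6 at which
`trace D(G⁶) = −1` and `det(D(G⁶) − I) = 0`; together with `det D(G⁶) = B̂⁶ = 1`, the
Jacobian of the sixth iterate there has eigenvalues `(−1, −1, +1)`. -/
theorem ghenon_period_six_lorenz_point_orientable :
    ∃ M₁ M₂ : ℝ,
      |M₁ - -0.9336687216264129| < 0.001 ∧ |M₂ - 1.99067193080051| < 0.001 ∧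
      ∃ p : ℝ × ℝ × ℝ,
        (ghenon M₁ M₂ 1)^[6] p = p ∧
        (∀ j : ℕ, 1 ≤ j → j ≤ 5 → (ghenon M₁ M₂ 1)^[j] p ≠ p) ∧
        LinearMap.trace ℝ (ℝ × ℝ × ℝ)
            (fderiv ℝ ((ghenon M₁ M₂ 1)^[6]) p).toLinearMap = -1 ∧
        LinearMap.det
            ((fderiv ℝ ((ghenon M₁ M₂ 1)^[6]) p).toLinearMap - LinearMap.id) = 0 ∧
        LinearMap.det (fderiv ℝ ((ghenon M₁ M₂ 1)^[6]) p).toLinearMap = 1 ∧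
        LinearMap.charpoly (fderiv ℝ ((ghenon M₁ M₂ 1)^[6]) p).toLinearMap =
          (X + 1) ^ 2 * (X - 1) := by
  obtain ⟨z, hz, hz0⟩ := exists_orbitSystem_eq_zero
  have hc : ∀ i, |z i - (approxZero i : ℝ) / 10 ^ 15| ≤ 1 / 10 ^ 7 := fun i =>
    (norm_le_pi_norm (z - fun i => (approxZero i : ℝ) / 10 ^ 15) i).trans hz
  have hM₁ := abs_le.1 (hc 6)
  have hM₂ := abs_le.1 (hc 7)
  have h0 := abs_le.1 (hc 0)
  have h1 := abs_le.1 (hc 1)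
  have h2 := abs_le.1 (hc 2)
  have h3 := abs_le.1 (hc 3)
  have h4 := abs_le.1 (hc 4)
  have h5 := abs_le.1 (hc 5)
  clear hc hz
  simp [approxZero] at hM₁ hM₂ h0 h1 h2 h3 h4 h5
  norm_num at hM₁ hM₂ h0 h1 h2 h3 h4 h5
  have e : ∀ i, orbitSystem z i = 0 := fun i => congrFun hz0 i
  simp [orbitSystem, Fin.forall_fin_succ] at e
  obtain ⟨e0, e1, e2, e3, e4, e5, v0, v1, v2, v3, v4, v5, w0, w1, w2, w3, w4, w5⟩ := e
  clear hz0
  have s0 : ghenon (z 6) (z 7) 1 (z 0, z 1, z 2) = (z 1, z 2, z 3) := by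
    ext <;> simp [ghenon]; linarith
  have s1 : ghenon (z 6) (z 7) 1 (z 1, z 2, z 3) = (z 2, z 3, z 4) := by
    ext <;> simp [ghenon]; linarith
  have s2 : ghenon (z 6) (z 7) 1 (z 2, z 3, z 4) = (z 3, z 4, z 5) := by
    ext <;> simp [ghenon]; linarith
  have s3 : ghenon (z 6) (z 7) 1 (z 3, z 4, z 5) = (z 4, z 5, z 0) := by
    ext <;> simp [ghenon]; linarith
  have s4 : ghenon (z 6) (z 7) 1 (z 4, z 5, z 0) = (z 5, z 0, z 1) := by
    ext <;> simp [ghenon]; linarith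
  have s5 : ghenon (z 6) (z 7) 1 (z 5, z 0, z 1) = (z 0, z 1, z 2) := by
    ext <;> simp [ghenon]; linarith
  have p1 : (ghenon (z 6) (z 7) 1)^[1] (z 0, z 1, z 2) = (z 1, z 2, z 3) := by
    exact s0
  have p2 : (ghenon (z 6) (z 7) 1)^[2] (z 0, z 1, z 2) = (z 2, z 3, z 4) := by
    rw [Function.iterate_succ_apply', p1, s1]
  have p3 : (ghenon (z 6) (z 7) 1)^[3] (z 0, z 1, z 2) = (z 3, z 4, z 5) := by
    rw [Function.iterate_succ_apply', p2, s2]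
  have p4 : (ghenon (z 6) (z 7) 1)^[4] (z 0, z 1, z 2) = (z 4, z 5, z 0) := by
    rw [Function.iterate_succ_apply', p3, s3]
  have p5 : (ghenon (z 6) (z 7) 1)^[5] (z 0, z 1, z 2) = (z 5, z 0, z 1) := by
    rw [Function.iterate_succ_apply', p4, s4]
  have p6 : (ghenon (z 6) (z 7) 1)^[6] (z 0, z 1, z 2) = (z 0, z 1, z 2) := by
    rw [Function.iterate_succ_apply', p5, s5]
  set D := (ghenonDeriv (z 7) (z 0)).comp ((ghenonDeriv (z 7) (z 5)).comp
    ((ghenonDeriv (z 7) (z 4)).comp ((ghenonDeriv (z 7) (z 3)).comp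
    ((ghenonDeriv (z 7) (z 2)).comp (ghenonDeriv (z 7) (z 1)))))) with hDdef
  have hD : HasFDerivAt (ghenon (z 6) (z 7) 1)^[6] D (z 0, z 1, z 2) :=
    (((((((hasFDerivAt_ghenon ..).iterate_succ' (n := 1) p1 (hasFDerivAt_ghenon ..)).iterate_succ'
      p2 (hasFDerivAt_ghenon ..)).iterate_succ' p3 (hasFDerivAt_ghenon ..)).iterate_succ'
      p4 (hasFDerivAt_ghenon ..)).iterate_succ' p5 (hasFDerivAt_ghenon ..)))
  have hdet : LinearMap.det D.toLinearMap = 1 := by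
    simp only [hDdef, ContinuousLinearMap.toLinearMap_comp, LinearMap.det_comp, det_ghenonDeriv,
      mul_one]
  have hv : D (1, z 8, z 9) = (1, z 8, z 9) := by
    have t0 : ghenonDeriv (z 7) (z 1) (1, z 8, z 9) = (z 8, z 9, z 10) := by
      ext <;> simp; linarith
    have t1 : ghenonDeriv (z 7) (z 2) (z 8, z 9, z 10) = (z 9, z 10, z 11) := by
      ext <;> simp; linarith
    have t2 : ghenonDeriv (z 7) (z 3) (z 9, z 10, z 11) = (z 10, z 11, z 12) := by
      ext <;> simp; linarith
    have t3 : ghenonDeriv (z 7) (z 4) (z 10, z 11, z 12) = (z 11, z 12, 1) := by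
      ext <;> simp; linarith
    have t4 : ghenonDeriv (z 7) (z 5) (z 11, z 12, 1) = (z 12, 1, z 8) := by
      ext <;> simp; linarith
    have t5 : ghenonDeriv (z 7) (z 0) (z 12, 1, z 8) = (1, z 8, z 9) := by
      ext <;> simp; linarith
    simp only [hDdef, ContinuousLinearMap.comp_apply, t0, t1, t2, t3, t4, t5]
  have hw : D (1, z 13, z 14) = -(1, z 13, z 14) := by
    have t0 : ghenonDeriv (z 7) (z 1) (1, z 13, z 14) = (z 13, z 14, z 15) := by
      ext <;> simp; linarith
    have t1 : ghenonDeriv (z 7) (z 2) (z 13, z 14, z 15) = (z 14, z 15, z 16) := by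
      ext <;> simp; linarith
    have t2 : ghenonDeriv (z 7) (z 3) (z 14, z 15, z 16) = (z 15, z 16, z 17) := by
      ext <;> simp; linarith
    have t3 : ghenonDeriv (z 7) (z 4) (z 15, z 16, z 17) = (z 16, z 17, -1) := by
      ext <;> simp; linarith
    have t4 : ghenonDeriv (z 7) (z 5) (z 16, z 17, -1) = (z 17, -1, -z 13) := by
      ext <;> simp; linarith
    have t5 : ghenonDeriv (z 7) (z 0) (z 17, -1, -z 13) = (-1, -z 13, -z 14) := by
      ext <;> simp; linarith
    simp only [hDdef, ContinuousLinearMap.comp_apply, t0, t1, t2, t3, t4, t5, Prod.neg_mk]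
  clear_value D
  have hrank : Module.finrank ℝ (ℝ × ℝ × ℝ) = 3 := by simp
  have hchar : D.toLinearMap.charpoly = (X + 1) ^ 2 * (X - 1) :=
    charpoly_eq_of_det_eq_one_of_eigenvectors hrank _ hdet
      (fun h => one_ne_zero (congrArg Prod.fst h)) hv
      (fun h => one_ne_zero (congrArg Prod.fst h)) hw
  refine ⟨z 6, z 7, ?_, ?_, (z 0, z 1, z 2), ?_, ?_, ?_⟩
  · rw [abs_lt]
    constructor <;> norm_num <;> linarith
  · rw [abs_lt]
    constructor <;> norm_num <;> linarith
  · exact p6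
  · intro j hj1 hj5 hj
    interval_cases j
    · rw [p1] at hj
      linarith [congrArg Prod.fst hj]
    · rw [p2] at hj
      linarith [congrArg Prod.fst hj]
    · rw [p3] at hj
      linarith [congrArg Prod.fst hj]
    · rw [p4] at hj
      linarith [congrArg Prod.fst hj]
    · rw [p5] at hj
      linarith [congrArg Prod.fst hj]
  · rw [hD.fderiv]
    refine ⟨?_, ?_, hdet, hchar⟩
    · rw [LinearMap.trace_eq_matrix_trace ℝ (Module.finBasisOfFinrankEq ℝ _ hrank),
        Matrix.trace_eq_neg_charpoly_coeff, LinearMap.charpoly_toMatrix, hchar,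
        show ((X + 1) ^ 2 * (X - 1) : ℝ[X]) = X ^ 3 + X ^ 2 - X - 1 by ring]
      simp [coeff_X, coeff_one, coeff_X_pow]
    · rw [LinearMap.det_eq_zero_iff_ker_ne_bot, Submodule.ne_bot_iff]
      exact ⟨(1, z 8, z 9), by simp [hv], fun h => one_ne_zero (congrArg Prod.fst h)⟩
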